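/- Let X ⊆ ℝ be compact, let f : X → X be continuous, and let μ be an f-invariant Borel probability measure on X (not necessarily ergodic). Then the Kolmogorov–Sinai entropy of f satisfies h_μ(f) = lim_{d→∞} h_μ(f, P_d) = sup_{d∈ℕ} h_μ(f, P_d), where P_d is the partition of X into the sets of points realizing the same ordinal pattern of order d. -/

import Mathlib

open MeasureTheory Filter Set Function
open scoped Classical ENNReal Topology

noncomputable section

/-- `ordIdx f d l x` is the inversion number `i_{d,l}(x)`, the `l`-th entry of the
ordinal pattern of order `d` realized by `x`:
`i_{d,l}(x) = #{r ∈ {0,…,l-1} : f^[d-r] x ≤ f^[d-l] x}`. -/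
def ordIdx {X : Set ℝ} (f : X → X) (d l : ℕ) (x : X) : ℕ :=
  ((Finset.range l).filter (fun r => f^[d - r] x ≤ f^[d - l] x)).card

/-- The partition `P_d = {P_i : i ∈ I_d}` of `X` into the sets of points realizing the
same ordinal pattern of order `d`, where an ordinal pattern `i ∈ I_d = ∏_{l=1}^d {0,…,l}`
is encoded as a dependent function `i : ∀ l : Fin d, Fin (l+2)` (so that `i l` is the
entry `i_{l+1} ∈ {0,…,l+1}`). -/
def patPartition {X : Set ℝ} (f : X → X) (d : ℕ) : Finset (Set X) :=
  Finset.image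
    (fun i : (∀ l : Fin d, Fin (l.val + 2)) =>
      {x : X | ∀ l : Fin d, ordIdx f d (l.val + 1) x = (i l).val})
    Finset.univ

/-- `𝒜` is a finite partition of `X` into Borel sets. -/
def IsFinPartition {X : Set ℝ} (𝒜 : Finset (Set X)) : Prop :=
  (∀ A ∈ 𝒜, MeasurableSet A) ∧
  (∀ A ∈ 𝒜, ∀ B ∈ 𝒜, A ≠ B → Disjoint A B) ∧
  ⋃₀ (𝒜 : Set (Set X)) = Set.univ

/-- The Shannon entropy `H(𝒜) = -∑_{A ∈ 𝒜} μ(A) ln μ(A)` of a finite partition `𝒜`. -/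
def partEntropy {X : Set ℝ} (μ : Measure X) (𝒜 : Finset (Set X)) : ℝ :=
  ∑ A ∈ 𝒜, Real.negMulLog (μ A).toReal

/-- The common refinement `⋁_{j=0}^{n-1} f^{-∘j}(𝒜)`, i.e. the partition of `X` into the
nonempty intersections `⋂_{j<n} f^{-∘j}(A_j)` with `A_j ∈ 𝒜`; it is the (unique up to
empty sets) partition generating the σ-algebra `⋁_{j=0}^{n-1} f^{-∘j}(𝒜)`. -/
def dynRefine {X : Set ℝ} (f : X → X) (𝒜 : Finset (Set X)) : ℕ → Finset (Set X)
  | 0 => {Set.univ}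
  | n + 1 =>
      ((dynRefine f 𝒜 n) ×ˢ (𝒜.image fun A => f^[n] ⁻¹' A)).image fun p => p.1 ∩ p.2

/-- `h_μ(f,𝒜) = lim_{n→∞} (1/n) H(⋁_{j=0}^{n-1} f^{-∘j}(𝒜))` (the limit exists and is
here expressed as a `limsup`). -/
def dynEntropy {X : Set ℝ} (μ : Measure X) (f : X → X) (𝒜 : Finset (Set X)) : ℝ :=
  Filter.limsup (fun n : ℕ => partEntropy μ (dynRefine f 𝒜 n) / n) Filter.atTop

/-- The Kolmogorov-Sinai entropy `h_μ(f) = sup {h_μ(f,𝒜) : 𝒜 finite Borel partition}`,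
as an extended nonnegative real. -/
def ksEntropy {X : Set ℝ} (μ : Measure X) (f : X → X) : ℝ≥0∞ :=
  ⨆ (𝒜 : Finset (Set X)) (_ : IsFinPartition 𝒜), ENNReal.ofReal (dynEntropy μ f 𝒜)

/-- The permutation entropy `h*_μ(f) = limsup_{d→∞} (1/d) H(P_d)`, as an extended
nonnegative real. -/
def permEntropy {X : Set ℝ} (μ : Measure X) (f : X → X) : ℝ≥0∞ :=
  Filter.limsup
    (fun d : ℕ => ENNReal.ofReal (partEntropy μ (patPartition f d)) / (d : ℝ≥0∞))
    Filter.atTop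

section FiniteValued

variable {Ω : Type*} [MeasurableSpace Ω] {ι κ τ : Type*}

/-- Shannon entropy of a function with finitely many values. -/
def valEntropy [Fintype ι] (μ : Measure Ω) (Y : Ω → ι) : ℝ :=
  ∑ i, Real.negMulLog (μ.real (Y ⁻¹' {i}))

/-- All fibres of `Y` are measurable. -/
def MeasFibres (Y : Ω → ι) : Prop := ∀ i, MeasurableSet (Y ⁻¹' {i})

lemma MeasFibres.prodMk {Y : Ω → ι} {Z : Ω → κ} (hY : MeasFibres Y) (hZ : MeasFibres Z) :
    MeasFibres (fun x => (Y x, Z x)) := by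
  rintro ⟨i, k⟩
  convert (hY i).inter (hZ k) using 1
  ext x
  simp

lemma MeasFibres.preimage [Finite ι] {Y : Ω → ι} (hY : MeasFibres Y) (S : Set ι) :
    MeasurableSet (Y ⁻¹' S) := by
  rw [← biUnion_preimage_singleton]
  exact MeasurableSet.biUnion (Set.to_countable S) fun i _ => hY i

lemma MeasFibres.pi [Finite κ] {Y : κ → Ω → ι} (hY : ∀ k, MeasFibres (Y k)) :
    MeasFibres (fun x k => Y k x) := by
  intro i
  have : (fun x k => Y k x) ⁻¹' {i} = ⋂ k, Y k ⁻¹' {i k} := by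
    ext x
    simp [funext_iff]
  rw [this]
  exact MeasurableSet.iInter fun k => hY k _

lemma MeasFibres.comp {f : Ω → Ω} (hf : Measurable f) {Y : Ω → ι} (hY : MeasFibres Y) :
    MeasFibres (Y ∘ f) := fun i => hf (hY i)

lemma negMulLog_sum_le {s : Finset ι} {p : ι → ℝ} (hp : ∀ i, 0 ≤ p i) :
    Real.negMulLog (∑ i ∈ s, p i) ≤ ∑ i ∈ s, Real.negMulLog (p i) := by
  rw [Real.negMulLog, ← Finset.sum_neg_distrib, Finset.sum_mul]
  refine Finset.sum_le_sum fun i hi => ?_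
  rcases (hp i).eq_or_lt with h | h
  · simp [← h]
  · have h1 : p i ≤ ∑ i ∈ s, p i := Finset.single_le_sum (fun j _ => hp j) hi
    have := Real.log_le_log h h1
    rw [Real.negMulLog]
    nlinarith

variable [Fintype ι] [Fintype κ] [Fintype τ] {μ : Measure Ω}

lemma valEntropy_nonneg [IsProbabilityMeasure μ] (Y : Ω → ι) : 0 ≤ valEntropy μ Y :=
  Finset.sum_nonneg fun _ _ => Real.negMulLog_nonneg measureReal_nonneg measureReal_le_one

lemma valEntropy_congr {Y Z : Ω → ι} (h : Y =ᵐ[μ] Z) : valEntropy μ Y = valEntropy μ Z := by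
  unfold valEntropy
  refine Finset.sum_congr rfl fun i _ => ?_
  congr 1
  refine measureReal_congr ?_
  filter_upwards [h] with x hx
  change (Y x = i) = (Z x = i)
  rw [hx]

lemma valEntropy_comp {f : Ω → Ω} (hf : MeasurePreserving f μ μ) {Y : Ω → ι}
    (hY : MeasFibres Y) : valEntropy μ (Y ∘ f) = valEntropy μ Y := by
  unfold valEntropy
  refine Finset.sum_congr rfl fun i _ => ?_
  rw [preimage_comp, hf.measureReal_preimage (hY i).nullMeasurableSet]

lemma sum_measureReal_fibre [IsFiniteMeasure μ] {Z : Ω → κ} (hZ : MeasFibres Z) {S : Set Ω}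
    (hS : MeasurableSet S) : ∑ k, μ.real (S ∩ Z ⁻¹' {k}) = μ.real S := by
  rw [← measureReal_biUnion_finset]
  · congr 1
    ext x
    simp
  · intro i _ j _ hij
    exact (((disjoint_singleton.2 hij).preimage Z).mono inter_subset_right inter_subset_right)
  · exact fun k _ => hS.inter (hZ k)

/-- If the values of `Y` determine those of `Z`, then `Z` has smaller entropy. -/
lemma valEntropy_mono [IsProbabilityMeasure μ] {Y : Ω → ι} {Z : Ω → κ} (hY : MeasFibres Y)
    (h : ∀ x y, Y x = Y y → Z x = Z y) : valEntropy μ Z ≤ valEntropy μ Y := by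
  obtain ⟨x₀⟩ : Nonempty Ω := μ.nonempty_of_neZero
  obtain ⟨g, rfl⟩ : ∃ g : ι → κ, Z = g ∘ Y := by
    have : Nonempty κ := ⟨Z x₀⟩
    exact (Function.factorsThrough_iff Z).1 fun x y hxy => h x y hxy
  unfold valEntropy
  rw [← Finset.sum_fiberwise Finset.univ g fun i => Real.negMulLog (μ.real (Y ⁻¹' {i}))]
  refine Finset.sum_le_sum fun k _ => le_trans (le_of_eq ?_)
    (negMulLog_sum_le fun i => measureReal_nonneg)
  congr 1
  rw [← measureReal_biUnion_finset]
  · congr 1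
    ext x
    simp
  · intro i _ j _ hij
    exact (disjoint_singleton.2 hij).preimage Y
  · exact fun k _ => hY k

lemma mul_log_ratio_le {p q r s : ℝ} (hp : 0 ≤ p) (hpq : p ≤ q) (hpr : p ≤ r) (hps : p ≤ s) :
    p * (Real.log q + Real.log r - Real.log p - Real.log s) ≤ q * r / s - p := by
  rcases hp.eq_or_lt with rfl | hp
  · simp only [zero_mul, sub_zero]
    positivity
  · have hq := hp.trans_le hpq
    have hr := hp.trans_le hpr
    have hs := hp.trans_le hps
    have h := Real.log_le_sub_one_of_pos (x := q * r / (p * s)) (by positivity)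
    rw [Real.log_div (by positivity) (by positivity), Real.log_mul hq.ne' hr.ne',
      Real.log_mul hp.ne' hs.ne'] at h
    have h2 := mul_le_mul_of_nonneg_left h hp.le
    have h3 : p * (q * r / (p * s) - 1) = q * r / s - p := by
      field_simp
    rw [h3] at h2
    linarith

/-- Strong subadditivity of the Shannon entropy. -/
lemma valEntropy_submodular [IsProbabilityMeasure μ] {X : Ω → ι} {Y : Ω → κ} {Z : Ω → τ}
    (hX : MeasFibres X) (hY : MeasFibres Y) (hZ : MeasFibres Z) :
    valEntropy μ (fun x => (X x, Y x, Z x)) + valEntropy μ Z ≤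
      valEntropy μ (fun x => (X x, Z x)) + valEntropy μ (fun x => (Y x, Z x)) := by
  set p : ι → κ → τ → ℝ := fun i j k => μ.real ((fun x => (X x, Y x, Z x)) ⁻¹' {(i, j, k)}) with hp
  set q : ι → τ → ℝ := fun i k => μ.real ((fun x => (X x, Z x)) ⁻¹' {(i, k)}) with hq
  set r : κ → τ → ℝ := fun j k => μ.real ((fun x => (Y x, Z x)) ⁻¹' {(j, k)}) with hr
  set s : τ → ℝ := fun k => μ.real (Z ⁻¹' {k}) with hs
  have hpq : ∀ i k, ∑ j, p i j k = q i k := by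
    intro i k
    refine (Finset.sum_congr rfl fun j _ => congrArg μ.real ?_).trans
      (sum_measureReal_fibre hY ((hX.prodMk hZ) (i, k)))
    ext x
    simp only [mem_preimage, mem_singleton_iff, Prod.mk.injEq, mem_inter_iff]
    tauto
  have hpr : ∀ j k, ∑ i, p i j k = r j k := by
    intro j k
    refine (Finset.sum_congr rfl fun i _ => congrArg μ.real ?_).trans
      (sum_measureReal_fibre hX ((hY.prodMk hZ) (j, k)))
    ext x
    simp only [mem_preimage, mem_singleton_iff, Prod.mk.injEq, mem_inter_iff]
    tauto
  have hqs : ∀ k, ∑ i, q i k = s k := by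
    intro k
    refine (Finset.sum_congr rfl fun i _ => congrArg μ.real ?_).trans
      (sum_measureReal_fibre hX (hZ k))
    ext x
    simp only [mem_preimage, mem_singleton_iff, Prod.mk.injEq, mem_inter_iff]
    tauto
  have hrs : ∀ k, ∑ j, r j k = s k := by
    intro k
    refine (Finset.sum_congr rfl fun i _ => congrArg μ.real ?_).trans
      (sum_measureReal_fibre hY (hZ k))
    ext x
    simp only [mem_preimage, mem_singleton_iff, Prod.mk.injEq, mem_inter_iff]
    tauto
  have p0 : ∀ i j k, 0 ≤ p i j k := fun i j k => measureReal_nonneg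
  have q0 : ∀ i k, 0 ≤ q i k := fun i k => measureReal_nonneg
  have ple_q : ∀ i j k, p i j k ≤ q i k := fun i j k => by
    rw [← hpq]; exact Finset.single_le_sum (fun j _ => p0 i j k) (Finset.mem_univ j)
  have ple_r : ∀ i j k, p i j k ≤ r j k := fun i j k => by
    rw [← hpr]; exact Finset.single_le_sum (f := fun i => p i j k) (fun i _ => p0 i j k)
      (Finset.mem_univ i)
  have qle_s : ∀ i k, q i k ≤ s k := fun i k => by
    rw [← hqs]; exact Finset.single_le_sum (f := fun i => q i k) (fun i _ => q0 i k)
      (Finset.mem_univ i)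
  have e1 : valEntropy μ (fun x => (X x, Y x, Z x)) =
      ∑ k, ∑ i, ∑ j, -(p i j k * Real.log (p i j k)) := by
    unfold valEntropy
    rw [Fintype.sum_prod_type, Finset.sum_comm]
    simp_rw [Fintype.sum_prod_type]
    rw [Finset.sum_comm]
    simp only [Real.negMulLog, hp, neg_mul]
    rw [Finset.sum_congr rfl fun i _ => Finset.sum_comm, Finset.sum_comm]
  have e2 : valEntropy μ Z = ∑ k, ∑ i, ∑ j, -(p i j k * Real.log (s k)) := by
    simp_rw [Finset.sum_neg_distrib, ← Finset.sum_mul, hpq, hqs]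
    simp [valEntropy, Real.negMulLog, hs]
  have e3 : valEntropy μ (fun x => (X x, Z x)) =
      ∑ k, ∑ i, ∑ j, -(p i j k * Real.log (q i k)) := by
    simp_rw [Finset.sum_neg_distrib, ← Finset.sum_mul, hpq]
    unfold valEntropy
    rw [Fintype.sum_prod_type, Finset.sum_comm]
    simp [Real.negMulLog, hq]
  have e4 : valEntropy μ (fun x => (Y x, Z x)) =
      ∑ k, ∑ i, ∑ j, -(p i j k * Real.log (r j k)) := by
    rw [Finset.sum_congr rfl fun i _ => Finset.sum_comm]
    simp_rw [Finset.sum_neg_distrib, ← Finset.sum_mul, hpr]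
    unfold valEntropy
    rw [Fintype.sum_prod_type, Finset.sum_comm]
    simp [Real.negMulLog, hr]
  have key : ∑ k, ∑ i, ∑ j, (p i j k *
      (Real.log (q i k) + Real.log (r j k) - Real.log (p i j k) - Real.log (s k))) ≤ 0 := by
    refine Finset.sum_nonpos fun k _ => ?_
    calc _ ≤ ∑ i, ∑ j, (q i k * r j k / s k - p i j k) :=
          Finset.sum_le_sum fun i _ => Finset.sum_le_sum fun j _ =>
            mul_log_ratio_le (p0 i j k) (ple_q i j k) (ple_r i j k)
              ((ple_q i j k).trans (qle_s i k))
      _ = s k * s k / s k - s k := by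
          simp_rw [Finset.sum_sub_distrib, hpq, hqs, ← Finset.sum_div, ← Finset.mul_sum, hrs,
            ← Finset.sum_mul, hqs]
      _ ≤ 0 := by simp
  rw [e1, e2, e3, e4, ← sub_nonpos]
  refine le_of_eq_of_le ?_ key
  simp_rw [← Finset.sum_add_distrib, ← Finset.sum_sub_distrib]
  refine Finset.sum_congr rfl fun k _ => Finset.sum_congr rfl fun i _ =>
    Finset.sum_congr rfl fun j _ => ?_
  ring

lemma valEntropy_const [IsProbabilityMeasure μ] (Y : Ω → ι) (h : ∀ x y, Y x = Y y) :
    valEntropy μ Y = 0 := by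
  refine le_antisymm ?_ (valEntropy_nonneg Y)
  have := valEntropy_mono (μ := μ) (Y := fun _ => ()) (Z := Y) (fun _ => by simp)
    (fun x y _ => h x y)
  simpa [valEntropy] using this

lemma valEntropy_prodMk_le [IsProbabilityMeasure μ] {X : Ω → ι} {Y : Ω → κ}
    (hX : MeasFibres X) (hY : MeasFibres Y) :
    valEntropy μ (fun x => (X x, Y x)) ≤ valEntropy μ X + valEntropy μ Y := by
  have hU : MeasFibres (fun _ : Ω => ()) := fun _ => by simp
  have h := valEntropy_submodular (μ := μ) hX hY hU
  rw [valEntropy_const (fun _ : Ω => ()) (fun _ _ => rfl), add_zero] at h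
  refine (valEntropy_mono (hX.prodMk (hY.prodMk hU)) ?_).trans (h.trans (add_le_add ?_ ?_))
  · simp +contextual
  · exact valEntropy_mono hX (by simp +contextual)
  · exact valEntropy_mono hY (by simp +contextual)

/-- The conditional entropy of `Y` given `Z` is small when `Y` and `Z` are close in measure. -/
lemma exists_valEntropy_prodMk_sub_le (ι : Type*) [Fintype ι] {ε : ℝ} (hε : 0 < ε) :
    ∃ δ > 0, ∀ (μ : Measure Ω) [IsProbabilityMeasure μ] (Y Z : Ω → ι), MeasFibres Y →
      MeasFibres Z → μ.real {x | Y x ≠ Z x} < δ →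
      valEntropy μ (fun x => (Y x, Z x)) - valEntropy μ Z ≤ ε := by
  have hu : UniformContinuousOn Real.negMulLog (Icc 0 1) :=
    isCompact_Icc.uniformContinuousOn_of_continuous Real.continuous_negMulLog.continuousOn
  set c : ℝ := (Fintype.card (ι × ι) : ℝ) + 1
  have hc : 0 < c := by positivity
  obtain ⟨δ, hδ, H⟩ := Metric.uniformContinuousOn_iff.1 hu (ε / c) (by positivity)
  refine ⟨δ, hδ, fun μ _ Y Z hY hZ hYZ => ?_⟩
  have e : valEntropy μ Z = ∑ a : ι × ι,
      Real.negMulLog (if a.1 = a.2 then μ.real (Z ⁻¹' {a.2}) else 0) := by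
    rw [Fintype.sum_prod_type, Finset.sum_comm]
    refine Finset.sum_congr rfl fun j _ => ?_
    rw [Finset.sum_eq_single j]
    · simp
    · intro i _ hij
      simp [hij]
    · simp
  rw [e, valEntropy, ← Finset.sum_sub_distrib]
  calc _ ≤ ∑ a : ι × ι, ε / c := by
        refine Finset.sum_le_sum fun a _ => ?_
        obtain ⟨i, j⟩ := a
        refine (le_abs_self _).trans (le_of_lt ?_)
        rw [← Real.dist_eq]
        refine H _ ⟨measureReal_nonneg, measureReal_le_one⟩ _ ?_ ?_
        · split_ifs
          · exact ⟨measureReal_nonneg, measureReal_le_one⟩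
          · simp
        · refine lt_of_le_of_lt ?_ hYZ
          by_cases hij : i = j
          · subst hij
            simp only [if_true]
            rw [Real.dist_eq, abs_sub_le_iff]
            constructor
            · refine (sub_nonpos.2 (measureReal_mono ?_)).trans measureReal_nonneg
              intro x
              simp
            · rw [sub_le_iff_le_add]
              refine (measureReal_mono ?_).trans (measureReal_union_le _ _)
              intro x hx
              by_cases h : Y x = Z x
              · right
                simp_all
              · exact Or.inl h
          · simp only [if_neg hij, Real.dist_eq, sub_zero, abs_of_nonneg measureReal_nonneg]
            refine measureReal_mono ?_
            intro x hx h
            simp only [mem_preimage, mem_singleton_iff, Prod.mk.injEq] at hx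
            exact hij (hx.1 ▸ hx.2 ▸ h)
    _ = (Fintype.card (ι × ι) : ℝ) * (ε / c) := by simp
    _ ≤ c * (ε / c) := by gcongr; simp [c]
    _ = ε := by field_simp

end FiniteValued

section Itinerary

variable {Ω ι κ : Type*}

/-- The first `n` symbols of the coding of the orbit of `x` by `Y`. -/
def itinerary (f : Ω → Ω) (Y : Ω → ι) (n : ℕ) (x : Ω) : Fin n → ι := fun j => Y (f^[j] x)

lemma itinerary_eq_iff {f : Ω → Ω} {Y : Ω → ι} {n : ℕ} {x y : Ω} :
    itinerary f Y n x = itinerary f Y n y ↔ ∀ j < n, Y (f^[j] x) = Y (f^[j] y) := by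
  simp [itinerary, funext_iff, Fin.forall_iff]

variable [MeasurableSpace Ω]

lemma MeasFibres.itinerary {f : Ω → Ω} (hf : Measurable f) {Y : Ω → ι} (hY : MeasFibres Y)
    (n : ℕ) : MeasFibres (itinerary f Y n) :=
  MeasFibres.pi fun j : Fin n => hY.comp (hf.iterate j)

variable [Fintype ι] [Fintype κ] {μ : Measure Ω} [IsProbabilityMeasure μ] {f : Ω → Ω}

lemma valEntropy_itinerary_le (hf : MeasurePreserving f μ μ) {Y : Ω → ι} (hY : MeasFibres Y)
    (n : ℕ) : valEntropy μ (itinerary f Y n) ≤ n * valEntropy μ Y := by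
  induction n with
  | zero => simp [valEntropy_const (itinerary f Y 0) fun _ _ => Subsingleton.elim _ _]
  | succ n ih =>
    have h1 := hY.itinerary hf.measurable n
    have h2 := hY.comp (hf.measurable.iterate n)
    calc _ ≤ valEntropy μ (fun x => (itinerary f Y n x, (Y ∘ f^[n]) x)) := by
          refine valEntropy_mono (h1.prodMk h2) fun x y h => ?_
          simp only [Prod.mk.injEq, itinerary_eq_iff, comp_apply] at h ⊢
          exact Nat.forall_lt_succ_right.2 h
      _ ≤ _ := valEntropy_prodMk_le h1 h2
      _ ≤ n * valEntropy μ Y + valEntropy μ Y := by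
          rw [valEntropy_comp (hf.iterate n) hY]
          gcongr
      _ = _ := by push_cast; ring

lemma valEntropy_itinerary_prodMk_le (hf : MeasurePreserving f μ μ) {Y : Ω → ι} {Z : Ω → κ}
    (hY : MeasFibres Y) (hZ : MeasFibres Z) (n : ℕ) :
    valEntropy μ (fun x => (itinerary f Y n x, itinerary f Z n x)) ≤
      valEntropy μ (itinerary f Z n) +
        n * (valEntropy μ (fun x => (Y x, Z x)) - valEntropy μ Z) := by
  induction n with
  | zero =>
    rw [valEntropy_const (fun x => (itinerary f Y 0 x, itinerary f Z 0 x))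
      fun _ _ => Subsingleton.elim _ _]
    simpa using valEntropy_nonneg _
  | succ n ih =>
    have hfn := hf.measurable.iterate n
    have hYn := hY.itinerary hf.measurable n
    have hZn := hZ.itinerary hf.measurable n
    have hY' := hY.comp hfn
    have hZ' := hZ.comp hfn
    have e1 : valEntropy μ (fun x => ((Y ∘ f^[n]) x, (Z ∘ f^[n]) x)) =
        valEntropy μ (fun x => (Y x, Z x)) := by
      rw [← valEntropy_comp (hf.iterate n) (hY.prodMk hZ)]
      simp only [comp_def]
    have e2 : valEntropy μ (Z ∘ f^[n]) = valEntropy μ Z := valEntropy_comp (hf.iterate n) hZ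
    have s1 := valEntropy_submodular (μ := μ) (hYn.prodMk hZn) hY' hZ'
    have s2 := valEntropy_submodular (μ := μ) hYn hZ' hZn
    have m1 : valEntropy μ (fun x => (itinerary f Y (n + 1) x, itinerary f Z (n + 1) x)) ≤
        valEntropy μ (fun x => ((itinerary f Y n x, itinerary f Z n x),
          (Y ∘ f^[n]) x, (Z ∘ f^[n]) x)) := by
      refine valEntropy_mono ((hYn.prodMk hZn).prodMk (hY'.prodMk hZ')) fun x y h => ?_
      simp only [Prod.mk.injEq, itinerary_eq_iff, comp_apply] at h ⊢
      exact ⟨Nat.forall_lt_succ_right.2 ⟨h.1.1, h.2.1⟩,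
        Nat.forall_lt_succ_right.2 ⟨h.1.2, h.2.2⟩⟩
    have m2 : valEntropy μ (fun x => ((itinerary f Y n x, itinerary f Z n x), (Z ∘ f^[n]) x)) ≤
        valEntropy μ (fun x => (itinerary f Y n x, (Z ∘ f^[n]) x, itinerary f Z n x)) := by
      refine valEntropy_mono (hYn.prodMk (hZ'.prodMk hZn)) fun x y h => ?_
      simp only [Prod.mk.injEq] at h ⊢
      tauto
    have m3 : valEntropy μ (fun x => ((Z ∘ f^[n]) x, itinerary f Z n x)) ≤
        valEntropy μ (itinerary f Z (n + 1)) := by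
      refine valEntropy_mono (hZ.itinerary hf.measurable (n + 1)) fun x y h => ?_
      simp only [Prod.mk.injEq, itinerary_eq_iff, comp_apply] at h ⊢
      exact (Nat.forall_lt_succ_right.1 h).symm
    push_cast
    linarith

/-- Joining with an almost invariant partition costs a bounded amount of entropy. -/
lemma valEntropy_itinerary_le_of_ae_invariant (hf : MeasurePreserving f μ μ) {B : Ω → ι}
    (hB : MeasFibres B) (hinv : B ∘ f =ᵐ[μ] B) (n : ℕ) :
    valEntropy μ (itinerary f B n) ≤ valEntropy μ B := by
  have h : ∀ j : ℕ, B ∘ f^[j] =ᵐ[μ] B := by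
    intro j
    induction j with
    | zero => rfl
    | succ j ih => exact (hf.quasiMeasurePreserving.ae_eq_comp ih).trans hinv
  have h' : itinerary f B n =ᵐ[μ] fun x _ => B x := by
    filter_upwards [ae_all_iff.2 h] with x hx
    ext j
    exact hx j
  rw [valEntropy_congr h']
  exact valEntropy_mono hB fun x y h => by simp [h]

end Itinerary

section Partition

variable {X : Set ℝ} {ι κ : Type*} [Fintype ι] [Fintype κ] {μ : Measure X} {f : X → X}

lemma partEntropy_image_fibre (Y : X → ι) :
    partEntropy μ (Finset.univ.image fun i => Y ⁻¹' {i}) = valEntropy μ Y := by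
  rw [partEntropy, Finset.sum_image_of_disjoint (by simp)]
  · rfl
  · intro i _ j _ hij
    exact (disjoint_singleton.2 hij).preimage Y

lemma dynRefine_image_fibre (Y : X → ι) (n : ℕ) :
    dynRefine f (Finset.univ.image fun i => Y ⁻¹' {i}) n =
      Finset.univ.image fun a => itinerary f Y n ⁻¹' {a} := by
  induction n with
  | zero =>
    ext S
    simp only [dynRefine, Finset.mem_singleton, Finset.mem_image, Finset.mem_univ, true_and]
    constructor
    · rintro rfl
      exact ⟨Fin.elim0, by ext x; simp [Subsingleton.elim (itinerary f Y 0 x) Fin.elim0]⟩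
    · rintro ⟨a, rfl⟩
      ext x
      simp [Subsingleton.elim (itinerary f Y 0 x) a]
  | succ n ih =>
    have key : ∀ (a : Fin n → ι) (i : ι), itinerary f Y n ⁻¹' {a} ∩ f^[n] ⁻¹' (Y ⁻¹' {i}) =
        itinerary f Y (n + 1) ⁻¹' {Fin.snoc (α := fun _ => ι) a i} := by
      intro a i
      ext x
      simp [funext_iff, itinerary, Fin.forall_fin_succ']
    ext S
    simp only [dynRefine, ih, Finset.mem_image, Finset.mem_product, Finset.mem_univ, true_and,
      Prod.exists]
    constructor
    · rintro ⟨_, _, ⟨⟨a, rfl⟩, _, ⟨i, rfl⟩, rfl⟩, rfl⟩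
      exact ⟨_, (key a i).symm⟩
    · rintro ⟨a, rfl⟩
      refine ⟨_, _, ⟨⟨Fin.init a, rfl⟩, _, ⟨a (Fin.last n), rfl⟩, rfl⟩, ?_⟩
      rw [key, Fin.snoc_init_self]

lemma dynEntropy_image_fibre (Y : X → ι) :
    dynEntropy μ f (Finset.univ.image fun i => Y ⁻¹' {i}) =
      limsup (fun n : ℕ => valEntropy μ (itinerary f Y n) / n) atTop := by
  simp only [dynEntropy, dynRefine_image_fibre, partEntropy_image_fibre]

/-- Every finite Borel partition consists of the fibres of a function. -/
lemma IsFinPartition.exists_fibres {𝒜 : Finset (Set X)} (h𝒜 : IsFinPartition 𝒜) :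
    ∃ Y : X → 𝒜, MeasFibres Y ∧ Finset.univ.image (fun A => Y ⁻¹' {A}) = 𝒜 := by
  obtain ⟨hm, hd, hU⟩ := h𝒜
  have hex : ∀ x : X, ∃ A : 𝒜, x ∈ A.1 := by
    intro x
    have : x ∈ ⋃₀ (𝒜 : Set (Set X)) := hU ▸ mem_univ x
    obtain ⟨A, hA, hx⟩ := this
    exact ⟨⟨A, hA⟩, hx⟩
  choose Y hY using hex
  have hfib : ∀ A : 𝒜, Y ⁻¹' {A} = A.1 := by
    intro A
    ext x
    constructor
    · rintro rfl
      exact hY x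
    · intro hx
      by_contra hne
      exact (hd _ (Y x).2 _ A.2 fun h => hne (Subtype.ext h)).ne_of_mem (hY x) hx rfl
  refine ⟨Y, fun A => hfib A ▸ hm _ A.2, ?_⟩
  simp only [hfib]
  exact Finset.univ_eq_attach 𝒜 ▸ Finset.attach_image_val

lemma MeasFibres.isFinPartition {Y : X → ι} (hY : MeasFibres Y) :
    IsFinPartition (Finset.univ.image fun i => Y ⁻¹' {i}) := by
  refine ⟨?_, ?_, ?_⟩
  · simpa using fun i => hY i
  · simp only [Finset.mem_image, Finset.mem_univ, true_and, forall_exists_index,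
      forall_apply_eq_imp_iff]
    intro i j hij
    exact (disjoint_singleton.2 fun h => hij (by rw [h])).preimage Y
  · ext x
    simp

/-- Comparison of entropy rates up to a linear error. -/
lemma dynEntropy_image_fibre_le [IsProbabilityMeasure μ] (hf : MeasurePreserving f μ μ)
    {Y : X → ι} {Z : X → κ} (hZ : MeasFibres Z) {c ε : ℝ}
    (h : ∀ n : ℕ, valEntropy μ (itinerary f Y n) ≤ valEntropy μ (itinerary f Z n) + c + n * ε) :
    dynEntropy μ f (Finset.univ.image fun i => Y ⁻¹' {i}) ≤
      dynEntropy μ f (Finset.univ.image fun i => Z ⁻¹' {i}) + ε := by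
  rw [dynEntropy_image_fibre, dynEntropy_image_fibre]
  set v : ℕ → ℝ := fun n => valEntropy μ (itinerary f Z n) / n
  have hvb : ∀ n, v n ≤ valEntropy μ Z := by
    intro n
    rcases Nat.eq_zero_or_pos n with rfl | hn
    · simpa [v] using valEntropy_nonneg Z
    · have : (0 : ℝ) < n := by exact_mod_cast hn
      rw [div_le_iff₀ this, mul_comm]
      exact valEntropy_itinerary_le hf hZ n
  have hv0 : ∀ n, 0 ≤ v n := fun n => div_nonneg (valEntropy_nonneg _) n.cast_nonneg
  have hvB : IsBoundedUnder (· ≤ ·) atTop v := isBoundedUnder_of ⟨_, hvb⟩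
  have huv : ∀ n ≥ 1, valEntropy μ (itinerary f Y n) / n ≤ v n + (c / n + ε) := by
    intro n hn
    have : (0 : ℝ) < n := by exact_mod_cast hn
    rw [div_le_iff₀ this]
    refine (h n).trans (le_of_eq ?_)
    simp only [v]
    field_simp
    ring
  refine le_of_forall_pos_le_add fun η hη => ?_
  have hlt : ∀ᶠ n in atTop, v n < limsup v atTop + η / 2 :=
    eventually_lt_of_limsup_lt (by linarith) hvB
  have hc : ∀ᶠ n : ℕ in atTop, c / n < η / 2 :=
    (tendsto_const_div_atTop_nhds_zero_nat c).eventually_lt_const (by positivity)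
  refine limsup_le_of_le ?_ ?_
  · exact IsCoboundedUnder.of_frequently_ge (a := 0) (Frequently.of_forall fun n =>
      div_nonneg (valEntropy_nonneg _) n.cast_nonneg)
  · filter_upwards [hlt, hc, eventually_ge_atTop 1] with n h1 h2 h3
    linarith [huv n h3]

end Partition

section VisitFrequency

variable {Ω : Type*} {f : Ω → Ω} {S T : Set Ω} {n : ℕ} {x : Ω}

/-- Proportion of the times `k < n` at which the orbit of `x` visits `S`. -/
def visitFreq (f : Ω → Ω) (S : Set Ω) (n : ℕ) (x : Ω) : ℝ :=
  birkhoffAverage ℝ f (S.indicator fun _ => (1 : ℝ)) n x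

lemma visitFreq_eq : visitFreq f S n x =
    (n : ℝ)⁻¹ * ∑ k ∈ Finset.range n, S.indicator (fun _ => (1 : ℝ)) (f^[k] x) := rfl

lemma visitFreq_eq_card : visitFreq f S n x =
    ((Finset.range n).filter fun k => f^[k] x ∈ S).card / n := by
  rw [visitFreq_eq, Finset.card_filter, div_eq_inv_mul]
  push_cast
  rfl

lemma visitFreq_nonneg : 0 ≤ visitFreq f S n x := by
  rw [visitFreq_eq_card]
  positivity

lemma visitFreq_mono (h : ∀ k, f^[k] x ∈ S → f^[k] x ∈ T) :
    visitFreq f S n x ≤ visitFreq f T n x := by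
  rw [visitFreq_eq_card, visitFreq_eq_card]
  have := Finset.card_le_card (Finset.monotone_filter_right (Finset.range n) fun k _ hk => h k hk)
  gcongr ?_ / _
  exact_mod_cast this

lemma visitFreq_le_one : visitFreq f S n x ≤ 1 := by
  rw [visitFreq_eq_card]
  refine div_le_one_of_le₀ ?_ n.cast_nonneg
  exact_mod_cast (Finset.card_filter_le _ _).trans (Finset.card_range n).le

lemma visitFreq_union (h : Disjoint S T) :
    visitFreq f (S ∪ T) n x = visitFreq f S n x + visitFreq f T n x := by
  simp only [visitFreq_eq, indicator_union_of_disjoint h, Finset.sum_add_distrib, mul_add]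

lemma tendsto_visitFreq_apply_sub (S : Set Ω) (x : Ω) :
    Tendsto (fun n => visitFreq f S n (f x) - visitFreq f S n x) atTop (𝓝 0) := by
  refine tendsto_birkhoffAverage_apply_sub_birkhoffAverage' ℝ ?_ f x
  refine (Metric.isBounded_Icc (0 : ℝ) 1).subset ?_
  rintro _ ⟨y, rfl⟩
  by_cases hy : y ∈ S <;> simp [hy]

lemma tendsto_visitFreq_apply_iff {ns : ℕ → ℕ} (hns : Tendsto ns atTop atTop) {c : ℝ} :
    Tendsto (fun j => visitFreq f S (ns j) (f x)) atTop (𝓝 c) ↔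
      Tendsto (fun j => visitFreq f S (ns j) x) atTop (𝓝 c) := by
  have h := (tendsto_visitFreq_apply_sub (f := f) S x).comp hns
  constructor
  · intro h'
    simpa using h'.sub h
  · intro h'
    simpa using h'.add h

lemma tendsto_visitFreq_iterate_iff {ns : ℕ → ℕ} (hns : Tendsto ns atTop atTop) {c : ℝ} (k : ℕ) :
    Tendsto (fun j => visitFreq f S (ns j) (f^[k] x)) atTop (𝓝 c) ↔
      Tendsto (fun j => visitFreq f S (ns j) x) atTop (𝓝 c) := by
  induction k with
  | zero => rfl
  | succ k ih => rw [iterate_succ_apply', tendsto_visitFreq_apply_iff hns, ih]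

lemma tendsto_visitFreq_zero_of_subset {ns : ℕ → ℕ}
    (h : ∀ k, f^[k] x ∈ S → f^[k] x ∈ T)
    (hT : Tendsto (fun j => visitFreq f T (ns j) x) atTop (𝓝 0)) :
    Tendsto (fun j => visitFreq f S (ns j) x) atTop (𝓝 0) :=
  squeeze_zero (fun _ => visitFreq_nonneg) (fun _ => visitFreq_mono h) hT

variable [MeasurableSpace Ω] {μ : Measure Ω}

lemma measurable_visitFreq (hf : Measurable f) (hS : MeasurableSet S) (n : ℕ) :
    Measurable (visitFreq f S n) := by
  have : visitFreq f S n = fun x =>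
    (n : ℝ)⁻¹ * ∑ k ∈ Finset.range n, S.indicator (fun _ => (1 : ℝ)) (f^[k] x) := rfl
  rw [this]
  exact (Finset.measurable_sum _ fun k _ =>
    (measurable_const.indicator hS).comp (hf.iterate k)).const_mul _

lemma integral_visitFreq [IsFiniteMeasure μ] (hf : MeasurePreserving f μ μ) (hS : MeasurableSet S)
    (hn : n ≠ 0) : ∫ x, visitFreq f S n x ∂μ = μ.real S := by
  have hm : Measurable (S.indicator fun _ => (1 : ℝ)) := measurable_const.indicator hS
  have hSint : Integrable (S.indicator fun _ => (1 : ℝ)) μ := (integrable_const _).indicator hS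
  have h : ∀ k, ∫ x, S.indicator (fun _ => (1 : ℝ)) (f^[k] x) ∂μ = μ.real S := by
    intro k
    have hk := hf.iterate k
    rw [← integral_map (φ := f^[k]) hk.aemeasurable hm.aestronglyMeasurable, hk.map_eq,
      integral_indicator_const _ hS, smul_eq_mul, mul_one]
  simp only [visitFreq_eq]
  rw [integral_const_mul, integral_finsetSum]
  · have : (n : ℝ) ≠ 0 := by exact_mod_cast hn
    simp [h]
    field_simp
  · exact fun k _ => (hf.iterate k).integrable_comp_of_integrable hSint

/-- Almost every point of `S` visits `S` with positive upper frequency, even along a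
prescribed sequence of times. -/
lemma ae_not_tendsto_visitFreq_zero [IsFiniteMeasure μ] (hf : MeasurePreserving f μ μ)
    (hS : MeasurableSet S) {ns : ℕ → ℕ} (hns : Tendsto ns atTop atTop) :
    ∀ᵐ x ∂μ, x ∈ S → ¬ Tendsto (fun j => visitFreq f S (ns j) x) atTop (𝓝 0) := by
  set Z : Set Ω := {x | Tendsto (fun j => visitFreq f S (ns j) x) atTop (𝓝 0)} with hZ
  have hZm : MeasurableSet Z :=
    measurableSet_tendsto _ fun j => measurable_visitFreq hf.measurable hS (ns j)
  have hSZ := hS.inter hZm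
  have hlim : ∀ x, Tendsto (fun j => visitFreq f (S ∩ Z) (ns j) x) atTop (𝓝 0) := by
    intro x
    by_cases hx : x ∈ Z
    · exact tendsto_visitFreq_zero_of_subset (fun k hk => hk.1) hx
    · have hk : ∀ k, f^[k] x ∉ S ∩ Z := fun k hk =>
        hx ((tendsto_visitFreq_iterate_iff hns k).1 hk.2)
      simp [visitFreq_eq_card, hk]
  have h := tendsto_integral_of_dominated_convergence (μ := μ) (f := fun _ => (0 : ℝ))
    (F := fun j => visitFreq f (S ∩ Z) (ns j)) (fun _ => 1)
    (fun j => (measurable_visitFreq hf.measurable hSZ (ns j)).aestronglyMeasurable)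
    (integrable_const _)
    (fun j => ae_of_all _ fun x => by
      rw [Real.norm_of_nonneg visitFreq_nonneg]; exact visitFreq_le_one)
    (ae_of_all _ hlim)
  have h' : Tendsto (fun j => ∫ x, visitFreq f (S ∩ Z) (ns j) x ∂μ) atTop (𝓝 (μ.real (S ∩ Z))) :=
    tendsto_const_nhds.congr' <| by
      filter_upwards [hns.eventually_ne_atTop 0] with j hj
      exact (integral_visitFreq hf hSZ hj).symm
  have h0 : μ.real (S ∩ Z) = 0 := by
    simpa using tendsto_nhds_unique h' h
  rw [measureReal_eq_zero_iff] at h0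
  filter_upwards [measure_eq_zero_iff_ae_notMem.1 h0] with x hx hxS hxZ
  exact hx ⟨hxS, hxZ⟩

/-- Almost every `x` with `a < v x` visits `{y | a < v y ≤ v x}` with positive upper frequency. -/
lemma ae_not_tendsto_visitFreq_Ioc [IsFiniteMeasure μ] (hf : MeasurePreserving f μ μ)
    {v : Ω → ℝ} (hv : Measurable v) (a : ℝ) {ns : ℕ → ℕ} (hns : Tendsto ns atTop atTop) :
    ∀ᵐ x ∂μ, a < v x →
      ¬ Tendsto (fun j => visitFreq f (v ⁻¹' Ioc a (v x)) (ns j) (f x)) atTop (𝓝 0) := by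
  set E : Set Ω := {x | a < v x ∧
    Tendsto (fun j => visitFreq f (v ⁻¹' Ioc a (v x)) (ns j) x) atTop (𝓝 0)} with hE
  have hmeas : ∀ n, Measurable fun x => visitFreq f (v ⁻¹' Ioc a (v x)) n x := by
    intro n
    have : (fun x => visitFreq f (v ⁻¹' Ioc a (v x)) n x) = fun x => (n : ℝ)⁻¹ *
        ∑ k ∈ Finset.range n, if a < v (f^[k] x) ∧ v (f^[k] x) ≤ v x then (1 : ℝ) else 0 := by
      ext x
      simp only [visitFreq_eq, indicator_apply, mem_preimage, mem_Ioc]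
    rw [this]
    refine (Finset.measurable_sum _ fun k _ => Measurable.ite ?_ measurable_const
      measurable_const).const_mul _
    have hk : Measurable fun x => v (f^[k] x) := hv.comp (hf.measurable.iterate k)
    exact (measurableSet_lt measurable_const hk).inter (measurableSet_le hk hv)
  have hEm : MeasurableSet E :=
    (measurableSet_lt measurable_const hv).inter (measurableSet_tendsto _ fun j => hmeas (ns j))
  have h1 := ae_not_tendsto_visitFreq_zero hf hEm hns
  have h2 : ∀ᵐ x ∂μ, ∀ c : ℚ, x ∈ E ∩ v ⁻¹' Iic (c : ℝ) →
      ¬ Tendsto (fun j => visitFreq f (E ∩ v ⁻¹' Iic (c : ℝ)) (ns j) x) atTop (𝓝 0) :=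
    ae_all_iff.2 fun c => ae_not_tendsto_visitFreq_zero hf (hEm.inter (hv measurableSet_Iic)) hns
  filter_upwards [h1, h2] with x hx1 hx2 hax hlim
  rw [tendsto_visitFreq_apply_iff hns] at hlim
  have hxE : x ∈ E := ⟨hax, hlim⟩
  refine hx1 hxE (tendsto_visitFreq_zero_of_subset (T := v ⁻¹' Ioc a (v x))
    (fun k hk => ⟨hk.1, ?_⟩) hlim)
  by_contra! hlt
  obtain ⟨c, hc1, hc2⟩ := exists_rat_btwn hlt
  exact hx2 c ⟨hxE, hc1.le⟩ (tendsto_visitFreq_zero_of_subset (T := v ⁻¹' Ioc a (v (f^[k] x)))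
    (fun i hi => ⟨hi.1.1, le_trans hi.2 hc2.le⟩)
    ((tendsto_visitFreq_iterate_iff hns k).1 hk.2))

/-- The mean ergodic theorem, in the form of almost everywhere convergence of a subsequence. -/
lemma exists_ae_tendsto_birkhoffAverage (hf : MeasurePreserving f μ μ) {g : Ω → ℝ}
    (hg : MemLp g 2 μ) : ∃ F : Ω → ℝ, Measurable F ∧ F ∘ f =ᵐ[μ] F ∧ ∃ ns : ℕ → ℕ,
      Tendsto ns atTop atTop ∧
        ∀ᵐ x ∂μ, Tendsto (fun j => birkhoffAverage ℝ f g (ns j) x) atTop (𝓝 (F x)) := by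
  let U : Lp ℝ 2 μ →L[ℝ] Lp ℝ 2 μ :=
    (Lp.compMeasurePreservingₗᵢ ℝ f hf).toContinuousLinearMap
  have hU : ‖U‖ ≤ 1 := LinearIsometry.norm_toContinuousLinearMap_le _
  have hUcoe : ∀ w : Lp ℝ 2 μ, (U w : Ω → ℝ) =ᵐ[μ] w ∘ f := fun w =>
    Lp.coeFn_compMeasurePreserving w hf
  set u : Lp ℝ 2 μ := hg.toLp g
  set L := (U.eqLocus (1 : Lp ℝ 2 μ →L[ℝ] Lp ℝ 2 μ)).orthogonalProjectionOnto u
  have hlim := U.tendsto_birkhoffAverage_orthogonalProjection hU u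
  have hiter : ∀ k, ((U^[k] u : Lp ℝ 2 μ) : Ω → ℝ) =ᵐ[μ] g ∘ f^[k] := by
    intro k
    induction k with
    | zero => exact hg.coeFn_toLp
    | succ k ih =>
      rw [iterate_succ_apply']
      exact (hUcoe _).trans (hf.quasiMeasurePreserving.ae_eq_comp ih)
  have hsum : ∀ n, ((birkhoffSum U _root_.id n u : Lp ℝ 2 μ) : Ω → ℝ) =ᵐ[μ] birkhoffSum f g n := by
    intro n
    induction n with
    | zero => exact Lp.coeFn_zero _ _ _
    | succ n ih =>
      rw [birkhoffSum_succ]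
      filter_upwards [Lp.coeFn_add (birkhoffSum U _root_.id n u) (U^[n] u), ih, hiter n]
        with x h1 h2 h3
      simp only [id_eq] at h1 ⊢
      rw [h1, birkhoffSum_succ, Pi.add_apply, h2, h3, comp_apply]
  have havg : ∀ n, ((birkhoffAverage ℝ U _root_.id n u : Lp ℝ 2 μ) : Ω → ℝ) =ᵐ[μ]
      birkhoffAverage ℝ f g n := by
    intro n
    filter_upwards [Lp.coeFn_smul ((n : ℝ)⁻¹) (birkhoffSum U _root_.id n u), hsum n] with x h1 h2
    rw [birkhoffAverage, h1, Pi.smul_apply, h2, birkhoffAverage]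
  obtain ⟨ns, hns, hae⟩ := (tendstoInMeasure_of_tendsto_Lp hlim).exists_seq_tendsto_ae
  obtain ⟨F, hFm, hF⟩ := (Lp.aestronglyMeasurable (L : Lp ℝ 2 μ)).aemeasurable
  have hfix : U (L : Lp ℝ 2 μ) = L := L.2
  refine ⟨F, hFm, ?_, ns, hns.tendsto_atTop, ?_⟩
  · calc F ∘ f =ᵐ[μ] (L : Lp ℝ 2 μ) ∘ f := (hf.quasiMeasurePreserving.ae_eq_comp hF).symm
      _ =ᵐ[μ] (U (L : Lp ℝ 2 μ) : Ω → ℝ) := (hUcoe _).symm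
      _ =ᵐ[μ] F := by rw [hfix]; exact hF
  · filter_upwards [hae, hF, ae_all_iff.2 havg] with x h1 h2 h3
    rw [← h2]
    simpa only [h3] using h1

end VisitFrequency

section OrdinalPattern

lemma le_iff_le_of_card_filter_eq {u v : ℕ → ℝ} {d : ℕ}
    (h : ∀ l ≤ d, ((Finset.range l).filter fun r => u r ≤ u l).card =
      ((Finset.range l).filter fun r => v r ≤ v l).card) :
    ∀ l ≤ d, ∀ r < l, (u r ≤ u l ↔ v r ≤ v l) := by
  intro l
  induction l using Nat.strong_induction_on with
  | _ l ih =>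
  intro hl
  have hcard := h l hl
  have heq : (Finset.range l).filter (fun r => u r ≤ u l) =
      (Finset.range l).filter (fun r => v r ≤ v l) := by
    by_cases hsub : (Finset.range l).filter (fun r => u r ≤ u l) ⊆
        (Finset.range l).filter (fun r => v r ≤ v l)
    · exact Finset.eq_of_subset_of_card_le hsub hcard.ge
    · refine (Finset.eq_of_subset_of_card_le (fun s hs => ?_) hcard.le).symm
      obtain ⟨r, hr, hr'⟩ := Finset.not_subset.1 hsub
      simp only [Finset.mem_filter, Finset.mem_range, not_and, not_le] at hr hr' hs ⊢
      refine ⟨hs.1, ?_⟩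
      have hv := hr' hr.1
      by_contra! hu
      rcases lt_trichotomy r s with hrs | rfl | hrs
      · have := (ih s hs.1 (hs.1.le.trans hl) r hrs).1 (hr.2.trans hu.le)
        linarith [hs.2]
      · linarith [hs.2]
      · have := (ih r hr.1 (hr.1.le.trans hl) s hrs).2 (hs.2.trans hv.le)
        linarith [hr.2]
  intro r hr
  simpa [hr] using Finset.ext_iff.1 heq r

variable {X : Set ℝ} {f : X → X}

lemma ordIdx_lt (d l : ℕ) (x : X) : ordIdx f d l x < l + 1 :=
  Nat.lt_succ_of_le ((Finset.card_filter_le _ _).trans (Finset.card_range l).le)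

/-- The ordinal pattern of order `d` realized by a point. -/
def ordPattern (f : X → X) (d : ℕ) (x : X) : ∀ l : Fin d, Fin (l.val + 2) :=
  fun l => ⟨ordIdx f d (l.val + 1) x, ordIdx_lt d (l.val + 1) x⟩

lemma ordPattern_eq_iff {d : ℕ} {x y : X} :
    ordPattern f d x = ordPattern f d y ↔ ∀ l ≤ d, ordIdx f d l x = ordIdx f d l y := by
  simp only [ordPattern, funext_iff, Fin.forall_iff, Fin.mk.injEq]
  constructor
  · intro h l hl
    rcases l with _ | l
    · simp [ordIdx]
    · exact h l hl
  · exact fun h l hl => h (l + 1) hl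

lemma patPartition_eq (f : X → X) (d : ℕ) :
    patPartition f d = Finset.univ.image fun i => ordPattern f d ⁻¹' {i} := by
  unfold patPartition
  congr 1
  ext i x
  simp [ordPattern, funext_iff, Fin.ext_iff]

lemma le_iff_le_of_ordPattern_eq {d : ℕ} {x y : X} (h : ordPattern f d x = ordPattern f d y)
    {l r : ℕ} (hl : l ≤ d) (hr : r < l) :
    f^[d - r] x ≤ f^[d - l] x ↔ f^[d - r] y ≤ f^[d - l] y :=
  le_iff_le_of_card_filter_eq (u := fun r => f^[d - r] x) (v := fun r => f^[d - r] y)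
    (ordPattern_eq_iff.1 h) l hl r hr

lemma ordPattern_eq_of_succ {d : ℕ} {x y : X}
    (h : ordPattern f (d + 1) x = ordPattern f (d + 1) y) :
    ordPattern f d x = ordPattern f d y := by
  rw [ordPattern_eq_iff]
  intro l hl
  unfold ordIdx
  congr 1
  refine Finset.filter_congr fun r hr => ?_
  have hr' := Finset.mem_range.1 hr
  simpa using le_iff_le_of_ordPattern_eq h (Nat.succ_le_succ hl) (Nat.succ_lt_succ hr')

lemma ordPattern_eq_of_le {d e : ℕ} (hde : d ≤ e) {x y : X}
    (h : ordPattern f e x = ordPattern f e y) : ordPattern f d x = ordPattern f d y := by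
  induction e, hde using Nat.le_induction with
  | base => exact h
  | succ e _ ih => exact ih (ordPattern_eq_of_succ h)

lemma measurable_ordIdx (hf : Measurable f) (d l : ℕ) : Measurable (ordIdx f d l) := by
  have : ordIdx f d l = fun x =>
      ∑ r ∈ Finset.range l, if f^[d - r] x ≤ f^[d - l] x then 1 else 0 := by
    ext x
    rw [ordIdx, Finset.card_filter]
  rw [this]
  exact Finset.measurable_sum _ fun r _ => Measurable.ite
    (measurableSet_le (hf.iterate _) (hf.iterate _)) measurable_const measurable_const

lemma measFibres_ordPattern (hf : Measurable f) (d : ℕ) : MeasFibres (ordPattern f d) := by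
  intro i
  have : ordPattern f d ⁻¹' {i} = ⋂ l : Fin d, ordIdx f d (l.val + 1) ⁻¹' {(i l).val} := by
    ext x
    simp [ordPattern, funext_iff, Fin.ext_iff]
  rw [this]
  exact MeasurableSet.iInter fun l => measurable_ordIdx hf _ _ (measurableSet_singleton _)

/-- The last entry of the ordinal pattern counts the visits of the orbit to the half line
below its starting point. -/
lemma ordIdx_self_div (f : X → X) (n : ℕ) (x : X) :
    (ordIdx f n n x : ℝ) / n = visitFreq f {y | y ≤ x} n (f x) := by
  rw [visitFreq_eq_card]
  congr 2
  refine Finset.card_bij' (fun r _ => n - 1 - r) (fun r _ => n - 1 - r) ?_ ?_ ?_ ?_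
  · intro r hr
    rw [Finset.mem_filter, Finset.mem_range] at hr ⊢
    refine ⟨by omega, ?_⟩
    change f^[n - 1 - r] (f x) ≤ x
    rw [← iterate_succ_apply, show (n - 1 - r).succ = n - r by omega]
    simpa using hr.2
  · intro r hr
    rw [Finset.mem_filter, Finset.mem_range] at hr ⊢
    refine ⟨by omega, ?_⟩
    have h : f^[r] (f x) ≤ x := hr.2
    rw [← iterate_succ_apply] at h
    rw [show n - (n - 1 - r) = r.succ by omega]
    simpa using h
  · intro r hr
    simp only [Finset.mem_filter, Finset.mem_range] at hr
    omega
  · intro r hr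
    simp only [Finset.mem_filter, Finset.mem_range] at hr
    omega

end OrdinalPattern

section Generation

variable {X : Set ℝ} {f : X → X} {μ : Measure X}

/-- The measurable sets determined by an ordinal pattern and finitely many sets that are
invariant modulo null sets. -/
def patternRing (μ : Measure X) (f : X → X) : Set (Set X) :=
  {R | MeasurableSet R ∧ ∃ (d : ℕ) (T : Finset (Set X)),
    (∀ S ∈ T, MeasurableSet S ∧ f ⁻¹' S =ᵐ[μ] S) ∧
    ∀ x y, ordPattern f d x = ordPattern f d y → (∀ S ∈ T, x ∈ S ↔ y ∈ S) → (x ∈ R ↔ y ∈ R)}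

lemma mem_patternRing_of_ordPattern {R : Set X} (hR : MeasurableSet R) (d : ℕ)
    (h : ∀ x y, ordPattern f d x = ordPattern f d y → (x ∈ R ↔ y ∈ R)) :
    R ∈ patternRing μ f :=
  ⟨hR, d, ∅, by simp, fun x y hxy _ => h x y hxy⟩

lemma mem_patternRing_of_ae_invariant {R : Set X} (hR : MeasurableSet R)
    (h : f ⁻¹' R =ᵐ[μ] R) : R ∈ patternRing μ f :=
  ⟨hR, 0, {R}, by simp [hR, h], fun x y _ hxy => hxy R (Finset.mem_singleton_self R)⟩

lemma exists_common_pattern {ι : Type*} [Fintype ι] {R : ι → Set X}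
    (hR : ∀ i, R i ∈ patternRing μ f) : ∃ (d : ℕ) (T : Finset (Set X)),
      (∀ S ∈ T, MeasurableSet S ∧ f ⁻¹' S =ᵐ[μ] S) ∧
      ∀ x y, ordPattern f d x = ordPattern f d y → (∀ S ∈ T, x ∈ S ↔ y ∈ S) →
        ∀ i, (x ∈ R i ↔ y ∈ R i) := by
  choose _ d T hT h using hR
  refine ⟨Finset.univ.sup d, Finset.univ.biUnion T, ?_, fun x y hxy hT i => ?_⟩
  · intro S hS
    obtain ⟨i, -, hi⟩ := Finset.mem_biUnion.1 hS
    exact hT i S hi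
  · exact h i x y (ordPattern_eq_of_le (Finset.le_sup (Finset.mem_univ i)) hxy)
      fun S hS => hT S (Finset.mem_biUnion.2 ⟨i, Finset.mem_univ i, hS⟩)

lemma mem_patternRing_of_mem {R S V : Set X} (hR : R ∈ patternRing μ f)
    (hS : S ∈ patternRing μ f) (hV : MeasurableSet V)
    (h : ∀ x y, (x ∈ R ↔ y ∈ R) → (x ∈ S ↔ y ∈ S) → (x ∈ V ↔ y ∈ V)) :
    V ∈ patternRing μ f := by
  obtain ⟨d, T, hT, hd⟩ := exists_common_pattern (R := fun b : Bool => cond b R S)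
    (Bool.forall_bool.2 ⟨hS, hR⟩)
  exact ⟨hV, d, T, hT, fun x y hp hxy => h x y (hd x y hp hxy true) (hd x y hp hxy false)⟩

lemma isSetRing_patternRing : IsSetRing (patternRing μ f) where
  empty_mem := mem_patternRing_of_ordPattern MeasurableSet.empty 0 (by simp)
  union_mem _ _ hR hS := mem_patternRing_of_mem hR hS (hR.1.union hS.1) fun x y h1 h2 => by
    simp [h1, h2]
  sdiff_mem _ _ hR hS := mem_patternRing_of_mem hR hS (hR.1.diff hS.1) fun x y h1 h2 => by
    simp [h1, h2]

lemma generateFrom_patternRing_le :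
    MeasurableSpace.generateFrom (patternRing μ f) ≤ Subtype.instMeasurableSpace :=
  MeasurableSpace.generateFrom_le fun _ h => h.1

lemma measurable_patternRing_ordIdx_self (hf : Measurable f) (n : ℕ) :
    Measurable[MeasurableSpace.generateFrom (patternRing μ f)] (ordIdx f n n) := by
  refine @measurable_to_countable' _ _ _ _ (_) _ fun k =>
    MeasurableSpace.measurableSet_generateFrom ?_
  refine mem_patternRing_of_ordPattern (measurable_ordIdx hf n n (measurableSet_singleton k)) n
    fun x y hxy => ?_
  simp [ordPattern_eq_iff.1 hxy n le_rfl]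

lemma measurable_patternRing_of_ae_invariant {F : X → ℝ} (hF : Measurable F)
    (h : F ∘ f =ᵐ[μ] F) :
    Measurable[MeasurableSpace.generateFrom (patternRing μ f)] F := by
  intro B hB
  refine MeasurableSpace.measurableSet_generateFrom (mem_patternRing_of_ae_invariant (hF hB) ?_)
  filter_upwards [h] with x hx
  change (F (f x) ∈ B) = (F x ∈ B)
  rw [← hx, comp_apply]

/-- Up to null sets, half lines are determined by ordinal patterns and invariant sets. -/
lemma exists_measurableSet_ae_eq_Ioi [IsFiniteMeasure μ] (hf : MeasurePreserving f μ μ) (a : ℝ) :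
    ∃ D, MeasurableSet[MeasurableSpace.generateFrom (patternRing μ f)] D ∧
      (Subtype.val ⁻¹' Ioi a : Set X) =ᵐ[μ] D := by
  have hSm : MeasurableSet (Subtype.val ⁻¹' Iic a : Set X) :=
    measurable_subtype_coe measurableSet_Iic
  obtain ⟨F, hFm, hFf, ns, hns, hlim⟩ := exists_ae_tendsto_birkhoffAverage hf
    (g := (Subtype.val ⁻¹' Iic a : Set X).indicator fun _ => (1 : ℝ))
    ((memLp_const 1).indicator hSm)
  refine ⟨{x | ∃ p : ℕ, ∃ᶠ j in atTop, F x + 1 / (p + 1) ≤ (ordIdx f (ns j) (ns j) x : ℝ) / ns j},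
    ?_, ?_⟩
  · simp only [frequently_atTop, ofPred_exists, ofPred_forall]
    have hF := measurable_patternRing_of_ae_invariant hFm hFf
    have hord := measurable_patternRing_ordIdx_self (μ := μ) hf.measurable
    let := MeasurableSpace.generateFrom (patternRing μ f)
    refine .iUnion fun p => .iInter fun i => .iUnion fun j => ?_
    by_cases hij : j ≥ i
    · simp only [hij, true_and]
      exact measurableSet_le (hF.add_const _)
        ((measurable_from_nat.comp (hord (ns j))).div_const (ns j : ℝ))
    · simp [hij]
  · filter_upwards [hlim, ae_not_tendsto_visitFreq_Ioc hf measurable_subtype_coe a hns]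
      with x h1 h2
    replace h1 : Tendsto (fun j => visitFreq f (Subtype.val ⁻¹' Iic a) (ns j) (f x)) atTop
      (𝓝 (F x)) := (tendsto_visitFreq_apply_iff hns).2 h1
    refine propext (Iff.trans (b := a < x.1) Iff.rfl ?_)
    change _ ↔ ∃ p : ℕ, ∃ᶠ j in atTop, F x + 1 / (p + 1) ≤ (ordIdx f (ns j) (ns j) x : ℝ) / ns j
    simp only [ordIdx_self_div]
    constructor
    · intro hax
      have hsplit : {y : X | y ≤ x} =
          (Subtype.val ⁻¹' Iic a : Set X) ∪ Subtype.val ⁻¹' Ioc a x.1 := by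
        rw [← preimage_union, Iic_union_Ioc_eq_Iic hax.le]
        rfl
      have hdisj : Disjoint (Subtype.val ⁻¹' Iic a : Set X) (Subtype.val ⁻¹' Ioc a x.1) :=
        (Iic_disjoint_Ioc le_rfl).preimage _
      have h3 := h2 hax
      simp only [Metric.tendsto_atTop, Real.dist_0_eq_abs, abs_of_nonneg visitFreq_nonneg] at h3
      push Not at h3
      obtain ⟨ε, hε, h3⟩ := h3
      obtain ⟨p, hp⟩ := exists_nat_one_div_lt (half_pos hε)
      refine ⟨p, ((frequently_atTop.2 h3).and_eventually
        (h1.eventually_const_lt (sub_lt_self (F x) (half_pos hε)))).mono fun j hj => ?_⟩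
      rw [hsplit, visitFreq_union hdisj]
      linarith [hj.1, hj.2]
    · rintro ⟨p, hp⟩
      by_contra! hxa
      have hpos : (0 : ℝ) < 1 / (p + 1) := by positivity
      refine hp ((h1.eventually_lt_const (lt_add_of_pos_right (F x) hpos)).mono fun j hj => ?_)
      rw [not_le]
      refine (visitFreq_mono fun k hk => ?_).trans_lt hj
      exact le_trans (Subtype.coe_le_coe.2 hk) hxa

lemma exists_mem_patternRing_measureReal_symmDiff_lt [IsFiniteMeasure μ]
    (hf : MeasurePreserving f μ μ) {A : Set X} (hA : MeasurableSet A) {δ : ℝ} (hδ : 0 < δ) :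
    ∃ R ∈ patternRing μ f, μ.real (symmDiff R A) < δ := by
  obtain ⟨D, hD, hAD⟩ : ∃ D, MeasurableSet[MeasurableSpace.generateFrom (patternRing μ f)] D ∧
      A =ᵐ[μ] D := by
    have hval : @Measurable _ _ (eventuallyMeasurableSpace
        (MeasurableSpace.generateFrom (patternRing μ f)) (ae μ)) _ (Subtype.val : X → ℝ) :=
      @measurable_of_Ioi _ _ _ _ _ (_) _ _ _ _ fun a => exists_measurableSet_ae_eq_Ioi hf a
    obtain ⟨B, hB, rfl⟩ := hA
    exact hval hB
  have hle := generateFrom_patternRing_le (μ := μ) (f := f)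
  obtain ⟨R, hR, hRD⟩ := @exists_measure_symmDiff_lt_of_generateFrom_isSetRing _
    (MeasurableSpace.generateFrom (patternRing μ f)) (μ.trim hle) _ _ isSetRing_patternRing
    ⟨{univ}, countable_singleton _, by
      simpa using mem_patternRing_of_ordPattern MeasurableSet.univ 0 (by simp), by simp⟩
    rfl _ hD _ (ENNReal.ofReal_pos.2 hδ)
  refine ⟨R, hR, ?_⟩
  rw [trim_measurableSet_eq hle (MeasurableSet.symmDiff
    (MeasurableSpace.measurableSet_generateFrom hR) hD)] at hRD
  rw [measureReal_def, ← ENNReal.lt_ofReal_iff_toReal_lt (measure_ne_top _ _),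
    measure_congr (EventuallyEq.rfl.symmDiff hAD)]
  exact hRD

end Generation

section Approximation

variable {X : Set ℝ} {f : X → X} {μ : Measure X} [IsProbabilityMeasure μ]

lemma measFibres_mem {Ω : Type*} [MeasurableSpace Ω] {S : Set Ω} (hS : MeasurableSet S) :
    MeasFibres (fun x => x ∈ S) := by
  intro p
  by_cases hp : p
  · convert hS using 1
    ext x
    simp [hp]
  · convert hS.compl using 1
    ext x
    simp [hp]

lemma measureReal_ne_le_sum {ι : Type*} [Fintype ι] (A R : ι → Set X) :
    μ.real {x | (fun i => x ∈ A i) ≠ fun i => x ∈ R i} ≤ ∑ i, μ.real (symmDiff (R i) (A i)) := by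
  refine (measureReal_mono ?_).trans (measureReal_iUnion_fintype_le _)
  intro x hx
  obtain ⟨i, hi⟩ := Function.ne_iff.1 hx
  refine mem_iUnion.2 ⟨i, ?_⟩
  rw [mem_symmDiff]
  by_cases h1 : x ∈ A i <;> by_cases h2 : x ∈ R i <;> simp_all

/-- The dynamical entropy of any finite measurable partition is approximated by that of
ordinal pattern partitions. -/
lemma exists_dynEntropy_le_patPartition_add (hf : MeasurePreserving f μ μ) {ι : Type*} [Fintype ι]
    {Y : X → ι} (hY : MeasFibres Y) {ε : ℝ} (hε : 0 < ε) :
    ∃ d, dynEntropy μ f (Finset.univ.image fun i => Y ⁻¹' {i}) ≤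
      dynEntropy μ f (patPartition f d) + ε := by
  obtain ⟨δ, hδ, hδε⟩ := exists_valEntropy_prodMk_sub_le (Ω := X) (ι → Prop) hε
  have hδ' : 0 < δ / (Fintype.card ι + 1) := by positivity
  choose R hR hRY using fun i =>
    exists_mem_patternRing_measureReal_symmDiff_lt hf (hY i) hδ'
  obtain ⟨d, T, hT, hdT⟩ := exists_common_pattern hR
  set A : X → ι → Prop := fun x i => x ∈ Y ⁻¹' {i}
  set C : X → ι → Prop := fun x i => x ∈ R i
  set B : X → T → Prop := fun x S => x ∈ S.1
  have hA : MeasFibres A := MeasFibres.pi fun i => measFibres_mem (hY i)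
  have hC : MeasFibres C := MeasFibres.pi fun i => measFibres_mem (hR i).1
  have hB : MeasFibres B := MeasFibres.pi fun S => measFibres_mem (hT S.1 S.2).1
  have hBinv : B ∘ f =ᵐ[μ] B := by
    filter_upwards [ae_all_iff.2 fun S : T => (hT S.1 S.2).2] with x hx
    exact funext fun S => hx S
  have hAC : valEntropy μ (fun x => (A x, C x)) - valEntropy μ C ≤ ε := by
    refine hδε μ A C hA hC ((measureReal_ne_le_sum _ _).trans_lt ?_)
    calc ∑ i, μ.real (symmDiff (R i) (Y ⁻¹' {i}))
        ≤ ∑ _i : ι, δ / (Fintype.card ι + 1) := Finset.sum_le_sum fun i _ => (hRY i).le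
      _ = δ * (Fintype.card ι / (Fintype.card ι + 1)) := by
        rw [Finset.sum_const, Finset.card_univ, nsmul_eq_mul]
        ring
      _ < δ := by
        refine mul_lt_of_lt_one_right hδ ?_
        rw [div_lt_one (by positivity)]
        linarith
  have hP := measFibres_ordPattern hf.measurable d
  refine ⟨d, ?_⟩
  rw [patPartition_eq]
  refine dynEntropy_image_fibre_le hf hP (c := valEntropy μ B) fun n => ?_
  have hAn := hA.itinerary hf.measurable n
  have hBn := hB.itinerary hf.measurable n
  have hCn := hC.itinerary hf.measurable n
  have hPn := hP.itinerary hf.measurable n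
  calc valEntropy μ (itinerary f Y n)
      ≤ valEntropy μ (fun x => (itinerary f A n x, itinerary f C n x)) := by
        refine valEntropy_mono (hAn.prodMk hCn) fun x y hxy => ?_
        rw [itinerary_eq_iff]
        intro j hj
        have hA' : itinerary f A n x = itinerary f A n y := congrArg Prod.fst hxy
        have h : A (f^[j] x) = A (f^[j] y) := itinerary_eq_iff.1 hA' j hj
        exact ((congrFun h (Y (f^[j] x))).mp rfl).symm
    _ ≤ valEntropy μ (itinerary f C n) +
        n * (valEntropy μ (fun x => (A x, C x)) - valEntropy μ C) :=
        valEntropy_itinerary_prodMk_le hf hA hC n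
    _ ≤ valEntropy μ (fun x => (itinerary f (ordPattern f d) n x, itinerary f B n x)) + n * ε := by
        gcongr
        refine valEntropy_mono (hPn.prodMk hBn) fun x y hxy => ?_
        rw [itinerary_eq_iff]
        intro j hj
        have h1 : itinerary f (ordPattern f d) n x = itinerary f (ordPattern f d) n y :=
          congrArg Prod.fst hxy
        have h2 : itinerary f B n x = itinerary f B n y := congrArg Prod.snd hxy
        refine funext fun i => propext (hdT _ _ (itinerary_eq_iff.1 h1 j hj) (fun S hS => ?_) i)
        exact (congrFun (itinerary_eq_iff.1 h2 j hj) ⟨S, hS⟩).to_iff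
    _ ≤ valEntropy μ (itinerary f (ordPattern f d) n) + valEntropy μ B + n * ε := by
        grw [valEntropy_prodMk_le hPn hBn, valEntropy_itinerary_le_of_ae_invariant hf hB hBinv n]

lemma monotone_dynEntropy_patPartition (hf : MeasurePreserving f μ μ) :
    Monotone fun d => dynEntropy μ f (patPartition f d) := by
  intro d e hde
  simp only [patPartition_eq]
  have hP := measFibres_ordPattern hf.measurable e
  have h := dynEntropy_image_fibre_le hf (Y := ordPattern f d) hP (c := 0) (ε := 0) fun n => by
    simp only [add_zero, mul_zero]
    refine valEntropy_mono (hP.itinerary hf.measurable n) fun x y hxy => ?_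
    rw [itinerary_eq_iff] at hxy ⊢
    exact fun j hj => ordPattern_eq_of_le hde (hxy j hj)
  simpa using h

lemma ksEntropy_eq_iSup_patPartition (hf : MeasurePreserving f μ μ) :
    ksEntropy μ f = ⨆ d : ℕ, ENNReal.ofReal (dynEntropy μ f (patPartition f d)) := by
  refine le_antisymm (iSup₂_le fun 𝒜 h𝒜 => ?_) (iSup_le fun d => ?_)
  · obtain ⟨Y, hY, h𝒜Y⟩ := h𝒜.exists_fibres
    refine ENNReal.le_of_forall_pos_le_add fun ε hε _ => ?_
    obtain ⟨d, hd⟩ := exists_dynEntropy_le_patPartition_add hf hY hε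
    rw [h𝒜Y] at hd
    calc ENNReal.ofReal (dynEntropy μ f 𝒜)
        ≤ ENNReal.ofReal (dynEntropy μ f (patPartition f d) + ε) := ENNReal.ofReal_le_ofReal hd
      _ ≤ ENNReal.ofReal (dynEntropy μ f (patPartition f d)) + ENNReal.ofReal ε :=
        ENNReal.ofReal_add_le
      _ ≤ _ := by
        rw [ENNReal.ofReal_coe_nnreal]
        gcongr
        exact le_iSup (fun d => ENNReal.ofReal (dynEntropy μ f (patPartition f d))) d
  · refine le_iSup₂_of_le (patPartition f d) ?_ le_rfl
    rw [patPartition_eq]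
    exact (measFibres_ordPattern hf.measurable d).isFinPartition

end Approximation

/-- For a continuous map on a compact set with invariant (not necessarily ergodic)
probability measure, the Kolmogorov-Sinai entropy is the limit (and the supremum)
of the entropies `h_μ(f, P_d)` of the ordinal pattern partitions. -/
theorem ksEntropy_eq_limit_ordinal_compact_continuous
    {X : Set ℝ} (hX : IsCompact X) (f : X → X) (hcont : Continuous f)
    (μ : Measure X) [IsProbabilityMeasure μ] (hf : MeasurePreserving f μ μ) :
    Tendsto (fun d : ℕ => ENNReal.ofReal (dynEntropy μ f (patPartition f d)))
      atTop (nhds (ksEntropy μ f)) ∧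
    ksEntropy μ f = ⨆ d : ℕ, ENNReal.ofReal (dynEntropy μ f (patPartition f d)) := by
  have hsup := ksEntropy_eq_iSup_patPartition hf
  refine ⟨?_, hsup⟩
  rw [hsup]
  exact tendsto_atTop_iSup fun d e hde =>
    ENNReal.ofReal_le_ofReal (monotone_dynEntropy_patPartition hf hde)
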